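/- For all integers i, j ≥ 1: if i + j is even then −∫_{−1}^{1} ∫_{−1}^{1} ln|x − s| · p_i(x) p_j(s) ds dx = 4 √(2i+1) √(2j+1) / ( (i+j)(i+j+2)(1 − (i−j)²) ), and if i + j is odd then this double integral equals 0. -/

import Mathlib

open MeasureTheory intervalIntegral

/-- Normalized Legendre polynomial on `[-1,1]`:
`p_n(x) = √(n + 1/2) · (1/(2ⁿ n!)) · (d/dx)ⁿ (x² − 1)ⁿ`, so `∫_{-1}^1 p_m p_n = δ_{mn}`. -/
noncomputable def legP (n : ℕ) (x : ℝ) : ℝ :=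
  Real.sqrt ((n : ℝ) + 1/2) * (1 / ((2:ℝ)^n * (Nat.factorial n : ℝ))) *
    iteratedDeriv n (fun y : ℝ => (y^2 - 1)^n) x

/-- `β_j = j(j+1)√(2j+1) / ((j+2)(j+3)√(2j+5))`. -/
noncomputable def betaC (j : ℕ) : ℝ :=
  ((j:ℝ) * ((j:ℝ) + 1) * Real.sqrt (2*(j:ℝ) + 1)) /
    (((j:ℝ) + 2) * ((j:ℝ) + 3) * Real.sqrt (2*(j:ℝ) + 5))

/-- `α_j = √(1 + β_j²)`. -/
noncomputable def alphaC (j : ℕ) : ℝ := Real.sqrt (1 + (betaC j)^2)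

/-- `q_j = (p_j − β_j p_{j+2}) / α_j`. -/
noncomputable def qP (j : ℕ) (x : ℝ) : ℝ := (legP j x - betaC j * legP (j+2) x) / alphaC j

open Polynomial

/-- The Legendre polynomial, given by the Rodrigues formula and normalized to take the value `1`
at `1`. -/
noncomputable def legendrePoly (n : ℕ) : ℝ[X] :=
  C (1 / ((2 : ℝ) ^ n * (n.factorial : ℝ))) * derivative^[n] ((X ^ 2 - 1) ^ n)

lemma iteratedDeriv_eval (p : ℝ[X]) (n : ℕ) :
    iteratedDeriv n (fun x => p.eval x) = fun x => (derivative^[n] p).eval x := by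
  induction n generalizing p with
  | zero => simp
  | succ n ih =>
    rw [iteratedDeriv_succ', Function.iterate_succ_apply, ← ih]
    congr 1
    ext x
    simp

lemma legP_eq_eval (n : ℕ) (x : ℝ) :
    legP n x = Real.sqrt ((n : ℝ) + 1 / 2) * (legendrePoly n).eval x := by
  have h := congrFun (iteratedDeriv_eval ((X ^ 2 - 1) ^ n) n) x
  simp only [eval_pow, eval_sub, eval_X, eval_one] at h
  rw [legP, h, legendrePoly, eval_mul, eval_C, mul_assoc]

lemma legendrePoly_zero : legendrePoly 0 = 1 := by simp [legendrePoly]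

lemma legendrePoly_succ_eq_C_mul (n : ℕ) (p : ℝ[X])
    (h : derivative^[n + 1] ((X ^ 2 - 1) ^ (n + 1) : ℝ[X]) = C (2 * (n + 1) : ℝ) * p) :
    legendrePoly (n + 1) = C (1 / ((2 : ℝ) ^ n * (n.factorial : ℝ))) * p := by
  rw [legendrePoly, h, ← mul_assoc, ← C_mul]
  congr 2
  have := n.factorial_ne_zero
  rw [Nat.factorial_succ, pow_succ]
  push_cast
  field_simp

/-- The derivative of order `n - 1` of `(x² - 1) ^ n`, normalized as in the Rodrigues formula. -/
noncomputable def legendreAux (n : ℕ) : ℝ[X] :=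
  C (1 / ((2 : ℝ) ^ n * (n.factorial : ℝ))) * derivative^[n - 1] ((X ^ 2 - 1) ^ n)

lemma C_mul_derivative_legendreAux (n : ℕ) :
    C (n : ℝ) * derivative (legendreAux n) = C (n : ℝ) * legendrePoly n := by
  cases n with
  | zero => simp
  | succ n =>
    rw [legendreAux, legendrePoly, derivative_C_mul, Function.iterate_succ_apply']
    simp

lemma legendrePoly_succ (n : ℕ) :
    legendrePoly (n + 1) = X * legendrePoly n + C (n : ℝ) * legendreAux n := by
  rw [legendrePoly_succ_eq_C_mul n
    (X * derivative^[n] ((X ^ 2 - 1) ^ n) + C (n : ℝ) * derivative^[n - 1] ((X ^ 2 - 1) ^ n)),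
    legendrePoly, legendreAux]
  · ring
  · have h : derivative ((X ^ 2 - 1) ^ (n + 1) : ℝ[X])
        = C (2 * (n + 1) : ℝ) * ((X ^ 2 - 1) ^ n * X) := by
      rw [derivative_pow]
      simp only [C_mul, C_add, C_1, map_natCast, map_ofNat, derivative_sub, derivative_one,
        derivative_X_pow, Nat.cast_add, Nat.cast_one, Nat.cast_ofNat, Nat.add_sub_cancel]
      ring
    rw [Function.iterate_succ_apply, h, iterate_derivative_C_mul, iterate_derivative_mul_X,
      nsmul_eq_mul, ← C_eq_natCast]
    ring

lemma iterate_derivative_mul_X_sq_sub_one (p : ℝ[X]) (n : ℕ) :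
    derivative^[n + 1] ((X ^ 2 - 1) * p) = (X ^ 2 - 1) * derivative^[n + 1] p
      + C (2 * (n + 1) : ℝ) * X * derivative^[n] p
      + C ((n + 1) * n : ℝ) * derivative^[n - 1] p := by
  have h : (X ^ 2 - 1) * p = p * X * X - p := by ring
  rw [h, iterate_derivative_sub, iterate_derivative_mul_X, Nat.add_sub_cancel,
    iterate_derivative_mul_X, iterate_derivative_mul_X]
  simp only [nsmul_eq_mul, Nat.add_sub_cancel, C_mul, C_add, C_1, map_natCast, Nat.cast_add,
    Nat.cast_one, map_ofNat]
  ring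

lemma one_sub_X_sq_mul_derivative_legendrePoly (n : ℕ) :
    (1 - X ^ 2) * derivative (legendrePoly n)
      = C (n + 1 : ℝ) * (X * legendrePoly n - legendrePoly (n + 1)) := by
  have h : C (2 * (n + 1) : ℝ) * legendrePoly (n + 1)
      = (X ^ 2 - 1) * derivative (legendrePoly n) + C (2 * (n + 1) : ℝ) * X * legendrePoly n
        + C ((n + 1) * n : ℝ) * legendreAux n := by
    have hn : derivative^[n + 1] ((X ^ 2 - 1) ^ (n + 1) : ℝ[X]) =
        C (2 * (n + 1) : ℝ) * (C (1 / (2 * (n + 1)) : ℝ) *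
          derivative^[n + 1] ((X ^ 2 - 1) * (X ^ 2 - 1) ^ n)) := by
      rw [← mul_assoc, ← C_mul, mul_one_div_cancel (by positivity), C_1, one_mul, pow_succ']
    have hc : C (2 * (n + 1) : ℝ) * C (1 / (2 * (n + 1)) : ℝ) = 1 := by
      rw [← C_mul, mul_one_div_cancel (by positivity), C_1]
    rw [legendrePoly_succ_eq_C_mul n _ hn, iterate_derivative_mul_X_sq_sub_one, legendrePoly,
      legendreAux, derivative_C_mul, Function.iterate_succ_apply']
    linear_combination (C (1 / ((2 : ℝ) ^ n * (n.factorial : ℝ))) *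
      ((X ^ 2 - 1) * derivative (derivative^[n] ((X ^ 2 - 1) ^ n))
      + C (2 * (n + 1) : ℝ) * X * derivative^[n] ((X ^ 2 - 1) ^ n)
      + C ((n + 1) * n : ℝ) * derivative^[n - 1] ((X ^ 2 - 1) ^ n))) * hc
  have h' := legendrePoly_succ n
  simp only [C_mul, C_add, C_1, map_ofNat] at h ⊢
  linear_combination h - (C (n : ℝ) + 1) * h'

lemma derivative_legendrePoly_succ (n : ℕ) :
    derivative (legendrePoly (n + 1))
      = X * derivative (legendrePoly n) + C (n + 1 : ℝ) * legendrePoly n := by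
  rw [legendrePoly_succ n, derivative_add, derivative_mul, derivative_X, derivative_C_mul,
    C_mul_derivative_legendreAux, C_add, C_1]
  ring

lemma legendrePoly_one : legendrePoly 1 = X := by
  simpa [legendrePoly_zero] using legendrePoly_succ 0

lemma legendrePoly_three_term (n : ℕ) :
    C (2 * n + 1 : ℝ) * (X * legendrePoly n)
      = C (n + 1 : ℝ) * legendrePoly (n + 1) + C (n : ℝ) * legendrePoly (n - 1) := by
  cases n with
  | zero => simp [legendrePoly_one, legendrePoly_zero]
  | succ n =>
    have h₀ := one_sub_X_sq_mul_derivative_legendrePoly n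
    have h₁ := one_sub_X_sq_mul_derivative_legendrePoly (n + 1)
    have h₂ := derivative_legendrePoly_succ n
    simp only [C_mul, C_add, C_1, map_ofNat, Nat.cast_add, Nat.cast_one,
      Nat.add_sub_cancel] at h₀ h₁ h₂ ⊢
    linear_combination X * h₀ - h₁ + (1 - X ^ 2) * h₂

/-- The derivative of `(1 - x²) p`. -/
noncomputable def conformalDeriv (p : ℝ[X]) : ℝ[X] := derivative ((1 - X ^ 2) * p)

lemma eval_conformalDeriv (p : ℝ[X]) (x : ℝ) :
    (conformalDeriv p).eval x = (1 - x ^ 2) * p.derivative.eval x - 2 * x * p.eval x := by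
  simp [conformalDeriv, derivative_mul]
  ring

lemma eval_conformalDeriv_legendrePoly (n : ℕ) (x : ℝ) :
    (2 * n + 1) * (conformalDeriv (legendrePoly n)).eval x
      = n * (n - 1) * (legendrePoly (n - 1)).eval x
        - (n + 1) * (n + 2) * (legendrePoly (n + 1)).eval x := by
  have h₁ := congrArg (eval x) (one_sub_X_sq_mul_derivative_legendrePoly n)
  have h₂ := congrArg (eval x) (legendrePoly_three_term n)
  simp only [eval_mul, eval_add, eval_sub, eval_C, eval_X, eval_one, eval_pow] at h₁ h₂
  rw [eval_conformalDeriv]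
  linear_combination (2 * n + 1 : ℝ) * h₁ + (n - 1 : ℝ) * h₂

/-- The logarithmic potential of `p` on `[-1, 1]`, with the kernel multiplied by `(x - s) ^ b`. -/
noncomputable def logMoment (b : ℕ) (p : ℝ[X]) (x : ℝ) : ℝ :=
  ∫ s in (-1 : ℝ)..1, (x - s) ^ b * Real.log (x - s) * p.eval s

lemma intervalIntegrable_pow_mul_log (n : ℕ) (a b : ℝ) :
    IntervalIntegrable (fun t => t ^ n * Real.log t) volume a b :=
  intervalIntegrable_log'.continuousOn_mul (continuous_pow n).continuousOn

lemma intervalIntegrable_logMoment (b : ℕ) (p : ℝ[X]) (x : ℝ) :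
    IntervalIntegrable (fun s => (x - s) ^ b * Real.log (x - s) * p.eval s) volume (-1) 1 := by
  have h := (intervalIntegrable_pow_mul_log b (x - -1) (x - 1)).comp_sub_left x
  simp only [sub_sub_cancel] at h
  exact h.mul_continuousOn p.continuous.continuousOn

lemma logMoment_add (b : ℕ) (p q : ℝ[X]) (x : ℝ) :
    logMoment b (p + q) x = logMoment b p x + logMoment b q x := by
  simp only [logMoment, eval_add, mul_add]
  exact integral_add (intervalIntegrable_logMoment b p x) (intervalIntegrable_logMoment b q x)

lemma logMoment_C_mul (b : ℕ) (c : ℝ) (p : ℝ[X]) (x : ℝ) :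
    logMoment b (C c * p) x = c * logMoment b p x := by
  simp only [logMoment, eval_mul, eval_C]
  rw [← intervalIntegral.integral_const_mul]
  congr 1
  ext s
  ring

lemma logMoment_X_mul (b : ℕ) (p : ℝ[X]) (x : ℝ) :
    logMoment b (X * p) x = x * logMoment b p x - logMoment (b + 1) p x := by
  simp only [logMoment]
  rw [← intervalIntegral.integral_const_mul, ← integral_sub
    ((intervalIntegrable_logMoment b p x).const_mul x) (intervalIntegrable_logMoment (b + 1) p x)]
  congr 1
  ext s
  simp only [eval_mul, eval_X]
  ring

lemma logMoment_one (b : ℕ) (x : ℝ) :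
    logMoment b 1 x
      = (∫ t in (0 : ℝ)..(x + 1), t ^ b * Real.log t)
        - ∫ t in (0 : ℝ)..(x - 1), t ^ b * Real.log t := by
  simp only [logMoment, eval_one, mul_one]
  rw [intervalIntegral.integral_comp_sub_left (fun t => t ^ b * Real.log t), sub_neg_eq_add,
    integral_interval_sub_left] <;> exact intervalIntegrable_pow_mul_log _ _ _

lemma hasDerivAt_integral_pow_mul_log (b : ℕ) {x : ℝ} (hx : x ≠ 0) :
    HasDerivAt (fun y => ∫ t in (0 : ℝ)..y, t ^ b * Real.log t) (x ^ b * Real.log x) x := by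
  refine integral_hasDerivAt_right (intervalIntegrable_pow_mul_log _ _ _) ?_ ?_
  · exact (Measurable.stronglyMeasurable (by fun_prop)).stronglyMeasurableAtFilter
  · exact (continuousAt_id.pow b).mul (Real.continuousAt_log hx)

lemma continuous_logMoment_and_hasDerivAt (p : ℝ[X]) (b : ℕ) :
    Continuous (logMoment b p) ∧ ∀ x : ℝ, x + 1 ≠ 0 → x - 1 ≠ 0 →
      HasDerivAt (logMoment b p)
        ((x + 1) ^ b * Real.log (x + 1) * p.eval (-1) - (x - 1) ^ b * Real.log (x - 1) * p.eval 1
          + logMoment b p.derivative x) x := by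
  induction p using Polynomial.induction_on generalizing b with
  | C a =>
    have h : logMoment b (C a) = fun x => a * ((∫ t in (0 : ℝ)..(x + 1), t ^ b * Real.log t)
        - ∫ t in (0 : ℝ)..(x - 1), t ^ b * Real.log t) := by
      ext x
      rw [← logMoment_one, ← logMoment_C_mul, mul_one]
    have hc := continuous_primitive (intervalIntegrable_pow_mul_log b) 0
    rw [h]
    refine ⟨by fun_prop, fun x h₁ h₂ => ?_⟩
    have hd := (((hasDerivAt_integral_pow_mul_log b h₁).comp_add_const x 1).sub
      ((hasDerivAt_integral_pow_mul_log b h₂).comp_sub_const x 1)).const_mul a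
    convert! hd using 1
    simp [logMoment]
    ring
  | add p q hp hq =>
    have h : logMoment b (p + q) = fun x => logMoment b p x + logMoment b q x :=
      funext (logMoment_add b p q)
    rw [h]
    refine ⟨(hp b).1.add (hq b).1, fun x h₁ h₂ => ?_⟩
    convert! ((hp b).2 x h₁ h₂).add ((hq b).2 x h₁ h₂) using 1
    rw [derivative_add, logMoment_add, eval_add, eval_add]
    ring
  | monomial n a ih =>
    have hX : C a * X ^ (n + 1) = X * (C a * X ^ n) := by ring
    rw [hX]
    generalize C a * X ^ n = q at ih
    have h : logMoment b (X * q) = fun x => x * logMoment b q x - logMoment (b + 1) q x :=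
      funext (logMoment_X_mul b q)
    rw [h]
    refine ⟨(continuous_id.mul (ih b).1).sub (ih (b + 1)).1, fun x h₁ h₂ => ?_⟩
    convert! ((hasDerivAt_id' x).mul ((ih b).2 x h₁ h₂)).sub ((ih (b + 1)).2 x h₁ h₂) using 1
    rw [derivative_mul, derivative_X, one_mul, logMoment_add, logMoment_X_mul, eval_mul, eval_mul,
      eval_X, eval_X]
    ring

/-- The logarithmic potential of `p` on `[-1, 1]`. -/
noncomputable def logPotential (p : ℝ[X]) (x : ℝ) : ℝ :=
  ∫ s in (-1 : ℝ)..1, Real.log (x - s) * p.eval s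

lemma logMoment_zero (p : ℝ[X]) : logMoment 0 p = logPotential p := by
  ext x
  simp [logMoment, logPotential]

lemma continuous_logPotential (p : ℝ[X]) : Continuous (logPotential p) :=
  logMoment_zero p ▸ (continuous_logMoment_and_hasDerivAt p 0).1

lemma hasDerivAt_logPotential (p : ℝ[X]) {x : ℝ} (hx : x ∈ Set.Ioo (-1 : ℝ) 1) :
    HasDerivAt (logPotential p)
      (Real.log (x + 1) * p.eval (-1) - Real.log (x - 1) * p.eval 1
        + logPotential p.derivative x) x := by
  have h := (continuous_logMoment_and_hasDerivAt p 0).2 x (by linarith [hx.1]) (by linarith [hx.2])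
  simpa [logMoment_zero] using h

lemma intervalIntegrable_logPotential (p : ℝ[X]) (x : ℝ) :
    IntervalIntegrable (fun s => Real.log (x - s) * p.eval s) volume (-1) 1 := by
  simpa using intervalIntegrable_logMoment 0 p x

lemma logPotential_add (p q : ℝ[X]) (x : ℝ) :
    logPotential (p + q) x = logPotential p x + logPotential q x := by
  simpa [logMoment_zero] using logMoment_add 0 p q x

lemma logPotential_C_mul (c : ℝ) (p : ℝ[X]) (x : ℝ) :
    logPotential (C c * p) x = c * logPotential p x := by
  simpa [logMoment_zero] using logMoment_C_mul 0 c p x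

/-- Integration by parts against the antiderivative `(x² - s²) p(s)`, which vanishes at the
singularity of the kernel. -/
lemma logPotential_derivative_sub_sq_mul (p : ℝ[X]) (x : ℝ) :
    logPotential (derivative ((C (x ^ 2) - X ^ 2) * p)) x
      = (x ^ 2 - 1) * (Real.log (x - 1) * p.eval 1 - Real.log (x + 1) * p.eval (-1))
        + ∫ s in (-1 : ℝ)..1, (x + s) * p.eval s := by
  set q := (C (x ^ 2) - X ^ 2) * p with hq
  have hcont : Continuous fun s => (x - s) * Real.log (x - s) * ((x + s) * p.eval s) := by
    have h : Continuous fun s : ℝ => (x - s) * Real.log (x - s) :=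
      Real.continuous_mul_log.comp (by fun_prop)
    exact h.mul (by fun_prop)
  have hpint : IntervalIntegrable (fun s => (x + s) * p.eval s) volume (-1) 1 :=
    Continuous.intervalIntegrable (by fun_prop) _ _
  have hF : ∀ s, (x - s) * Real.log (x - s) * ((x + s) * p.eval s)
      = Real.log (x - s) * q.eval s := by
    intro s
    simp [hq]
    ring
  have h := integral_eq_of_hasDerivAt_off_countable_of_le
    (fun s => Real.log (x - s) * q.eval s)
    (fun s => Real.log (x - s) * (derivative q).eval s - (x + s) * p.eval s)
    (show (-1 : ℝ) ≤ 1 by norm_num) (Set.countable_singleton x)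
    (by simpa only [hF] using hcont.continuousOn) ?_
    ((intervalIntegrable_logPotential _ x).sub hpint)
  · rw [integral_sub (intervalIntegrable_logPotential _ x) hpint] at h
    rw [logPotential, eq_add_of_sub_eq h]
    simp [hq]
    ring
  · rintro s ⟨-, hs⟩
    have hs : x - s ≠ 0 := sub_ne_zero.2 fun h => hs h.symm
    convert! (((hasDerivAt_id' s).const_sub x).log hs).mul (q.hasDerivAt s) using 1
    simp only [hq, eval_mul, eval_sub, eval_pow, eval_C, eval_X]
    field_simp
    ring

lemma one_sub_sq_mul_deriv_logPotential (p : ℝ[X]) (x : ℝ) :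
    (1 - x ^ 2) * (Real.log (x + 1) * p.eval (-1) - Real.log (x - 1) * p.eval 1
        + logPotential p.derivative x)
      = logPotential (conformalDeriv p) x - ∫ s in (-1 : ℝ)..1, (x + s) * p.eval s := by
  have h : conformalDeriv p
      = derivative ((C (x ^ 2) - X ^ 2) * p) + C (1 - x ^ 2) * derivative p := by
    simp only [conformalDeriv, derivative_mul, derivative_sub, derivative_one, derivative_C,
      C_sub, C_1]
    ring
  rw [h, logPotential_add, logPotential_C_mul, logPotential_derivative_sub_sq_mul]
  ring

/-- Integration by parts against the vector field `(1 - x²) d/dx`, without boundary terms. -/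
lemma integral_conformalDeriv_mul_add {u u' r : ℝ → ℝ} (p : ℝ[X]) (hu : Continuous u)
    (hr : Continuous r) (hd : ∀ x ∈ Set.Ioo (-1 : ℝ) 1, HasDerivAt u (u' x) x)
    (h : ∀ x ∈ Set.Ioo (-1 : ℝ) 1, (1 - x ^ 2) * u' x = r x) :
    ∫ x in (-1 : ℝ)..1, ((conformalDeriv p).eval x * u x + p.eval x * r x) = 0 := by
  rw [integral_eq_sub_of_hasDerivAt_of_le (f := fun x => ((1 - X ^ 2) * p).eval x * u x)
    (by norm_num) (Continuous.continuousOn (by fun_prop)) ?_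
    (Continuous.intervalIntegrable (by fun_prop) _ _)]
  · simp
  · intro x hx
    convert! (((1 - X ^ 2) * p).hasDerivAt x).mul (hd x hx) using 1
    rw [← h x hx, conformalDeriv]
    simp
    ring

/-- The bilinear form of the logarithmic kernel on `[-1, 1]`. -/
noncomputable def logForm (p q : ℝ[X]) : ℝ :=
  ∫ x in (-1 : ℝ)..1, p.eval x * logPotential q x

lemma intervalIntegrable_logForm (p q : ℝ[X]) :
    IntervalIntegrable (fun x => p.eval x * logPotential q x) volume (-1) 1 :=
  (p.continuous.mul (continuous_logPotential q)).intervalIntegrable _ _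

lemma logForm_conformalDeriv (p q : ℝ[X]) (hp : ∫ x in (-1 : ℝ)..1, p.eval x = 0)
    (hq : ∫ x in (-1 : ℝ)..1, q.eval x = 0) :
    logForm (conformalDeriv p) q + logForm p (conformalDeriv q) = 0 := by
  have hm : ∀ x : ℝ, ∫ s in (-1 : ℝ)..1, (x + s) * q.eval s
      = ∫ s in (-1 : ℝ)..1, s * q.eval s := by
    intro x
    simp only [add_mul]
    rw [intervalIntegral.integral_add, intervalIntegral.integral_const_mul, hq, mul_zero,
      zero_add] <;>
      exact Continuous.intervalIntegrable (by fun_prop) _ _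
  have h := integral_conformalDeriv_mul_add p (continuous_logPotential q)
    (r := fun x => logPotential (conformalDeriv q) x - ∫ s in (-1 : ℝ)..1, s * q.eval s)
    ((continuous_logPotential _).sub continuous_const)
    (fun x hx => hasDerivAt_logPotential q hx)
    (fun x _ => by rw [one_sub_sq_mul_deriv_logPotential, hm])
  simp only [mul_sub, ← add_sub_assoc] at h
  rw [integral_sub
      ((intervalIntegrable_logForm _ _).add (intervalIntegrable_logForm _ _))
      (Continuous.intervalIntegrable (by fun_prop) _ _),
    integral_add (intervalIntegrable_logForm _ _) (intervalIntegrable_logForm _ _),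
    intervalIntegral.integral_mul_const, hp, zero_mul, sub_zero] at h
  exact h

lemma logPotential_X (x : ℝ) :
    logPotential X x = (1 - x ^ 2) / 2 * (Real.log (x - 1) - Real.log (x + 1)) - x := by
  have h := logPotential_derivative_sub_sq_mul 1 x
  have hd : derivative ((C (x ^ 2) - X ^ 2) * 1) = C (-2 : ℝ) * X := by
    rw [mul_one, derivative_sub, derivative_C, derivative_X_pow, C_neg]
    simp
  rw [hd, logPotential_C_mul] at h
  simp only [eval_one, mul_one] at h
  rw [intervalIntegral.integral_add (by simp) (by simp), integral_id,
    intervalIntegral.integral_const] at h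
  norm_num at h
  linarith

lemma logForm_conformalDeriv_X (p : ℝ[X]) :
    logForm (conformalDeriv p - C 2 * X * p) X = 2 * ∫ x in (-1 : ℝ)..1, p.eval x := by
  have h := integral_conformalDeriv_mul_add p (continuous_logPotential X)
    (r := fun x => -2 - 2 * x * logPotential X x)
    (u' := fun x => x * (Real.log (x + 1) - Real.log (x - 1)) - 2)
    (by have := continuous_logPotential X; fun_prop) ?_ ?_
  · rw [← sub_eq_zero, ← h, logForm, ← intervalIntegral.integral_const_mul, ← integral_sub
      (intervalIntegrable_logForm _ _) (Continuous.intervalIntegrable (by fun_prop) _ _)]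
    congr 1
    ext x
    simp
    ring
  · intro x hx
    have h₁ : x - 1 ≠ 0 := by linarith [hx.2]
    have h₂ : x + 1 ≠ 0 := by linarith [hx.1]
    rw [funext logPotential_X]
    convert! ((((hasDerivAt_pow 2 x).const_sub 1).div_const 2).mul
      ((((hasDerivAt_id' x).sub_const 1).log h₁).sub
      (((hasDerivAt_id' x).add_const 1).log h₂))).sub (hasDerivAt_id' x) using 1
    simp only [Pi.sub_apply]
    field_simp
    ring
  · intro x _
    simp only [logPotential_X]
    ring

lemma logForm_one_X : logForm 1 X = 0 := by
  have hodd : ∀ x, logPotential X (-x) = -logPotential X x := by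
    intro x
    rw [logPotential_X, logPotential_X, ← Real.log_neg_eq_log (-x - 1),
      ← Real.log_neg_eq_log (-x + 1), show -(-x - 1) = x + 1 by ring,
      show -(-x + 1) = x - 1 by ring]
    ring
  have h := intervalIntegral.integral_comp_neg (a := -1) (b := 1) (logPotential X)
  simp only [hodd, intervalIntegral.integral_neg, neg_neg] at h
  simp only [logForm, eval_one, one_mul]
  linarith

lemma logPotential_C_mul_add_C_mul (a b : ℝ) (p q : ℝ[X]) (x : ℝ) :
    logPotential (C a * p + C b * q) x = a * logPotential p x + b * logPotential q x := by
  rw [logPotential_add, logPotential_C_mul, logPotential_C_mul]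

lemma logForm_C_mul_add_C_mul_left (a b : ℝ) (p q r : ℝ[X]) :
    logForm (C a * p + C b * q) r = a * logForm p r + b * logForm q r := by
  simp only [logForm]
  rw [← intervalIntegral.integral_const_mul, ← intervalIntegral.integral_const_mul,
    ← intervalIntegral.integral_add ((intervalIntegrable_logForm p r).const_mul a)
      ((intervalIntegrable_logForm q r).const_mul b)]
  congr 1
  ext x
  simp
  ring

lemma logForm_C_mul_add_C_mul_right (a b : ℝ) (p q r : ℝ[X]) :
    logForm p (C a * q + C b * r) = a * logForm p q + b * logForm p r := by
  simp only [logForm, logPotential_C_mul_add_C_mul]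
  rw [← intervalIntegral.integral_const_mul, ← intervalIntegral.integral_const_mul,
    ← intervalIntegral.integral_add ((intervalIntegrable_logForm p q).const_mul a)
      ((intervalIntegrable_logForm p r).const_mul b)]
  congr 1
  ext x
  ring

lemma conformalDeriv_legendrePoly (n : ℕ) :
    conformalDeriv (legendrePoly n)
      = C (n * (n - 1) / (2 * n + 1) : ℝ) * legendrePoly (n - 1)
        + C (-((n + 1) * (n + 2)) / (2 * n + 1) : ℝ) * legendrePoly (n + 1) := by
  refine Polynomial.funext fun x => ?_
  have h := eval_conformalDeriv_legendrePoly n x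
  simp only [eval_add, eval_mul, eval_C]
  field_simp
  linear_combination h

lemma conformalDeriv_legendrePoly_sub (n : ℕ) :
    conformalDeriv (legendrePoly n) - C 2 * X * legendrePoly n
      = C (n * (n - 3) / (2 * n + 1) : ℝ) * legendrePoly (n - 1)
        + C (-((n + 1) * (n + 4)) / (2 * n + 1) : ℝ) * legendrePoly (n + 1) := by
  refine Polynomial.funext fun x => ?_
  have h := eval_conformalDeriv_legendrePoly n x
  have h' := congrArg (eval x) (legendrePoly_three_term n)
  simp only [eval_add, eval_sub, eval_mul, eval_C, eval_X] at h' ⊢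
  field_simp
  linear_combination h - 2 * h'

lemma integral_conformalDeriv (p : ℝ[X]) :
    ∫ x in (-1 : ℝ)..1, (conformalDeriv p).eval x = 0 := by
  simpa using integral_conformalDeriv_mul_add p (continuous_const (y := (1 : ℝ)))
    (continuous_const (y := (0 : ℝ))) (fun x _ => hasDerivAt_const x (1 : ℝ)) (by simp)

lemma integral_legendrePoly_succ (n : ℕ) :
    ∫ x in (-1 : ℝ)..1, (legendrePoly (n + 1)).eval x = 0 := by
  have h (m : ℕ) : (m * (m - 1) : ℝ) * (∫ x in (-1 : ℝ)..1, (legendrePoly (m - 1)).eval x)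
      = (m + 1) * (m + 2) * ∫ x in (-1 : ℝ)..1, (legendrePoly (m + 1)).eval x := by
    rw [← sub_eq_zero, ← intervalIntegral.integral_const_mul,
      ← intervalIntegral.integral_const_mul, ← intervalIntegral.integral_sub
        (Continuous.intervalIntegrable (by fun_prop) _ _)
        (Continuous.intervalIntegrable (by fun_prop) _ _)]
    simp only [← eval_conformalDeriv_legendrePoly]
    rw [intervalIntegral.integral_const_mul, integral_conformalDeriv, mul_zero]
  induction n using Nat.twoStepInduction with
  | zero => simp [legendrePoly_one]
  | one =>
    have := h 1
    norm_num at this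
    exact this
  | more n ih _ =>
    have := h (n + 2)
    rw [show n + 2 - 1 = n + 1 by lia, ih, mul_zero, eq_comm, mul_eq_zero] at this
    exact this.resolve_left (by positivity)

lemma logForm_legendrePoly_recurrence {i j : ℕ} (hi : 1 ≤ i) (hj : 1 ≤ j) :
    (i * (i - 1) / (2 * i + 1) : ℝ) * logForm (legendrePoly (i - 1)) (legendrePoly j)
      + (-((i + 1) * (i + 2)) / (2 * i + 1) : ℝ)
        * logForm (legendrePoly (i + 1)) (legendrePoly j)
      + ((j * (j - 1) / (2 * j + 1) : ℝ) * logForm (legendrePoly i) (legendrePoly (j - 1))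
      + (-((j + 1) * (j + 2)) / (2 * j + 1) : ℝ)
        * logForm (legendrePoly i) (legendrePoly (j + 1))) = 0 := by
  obtain ⟨i, rfl⟩ := Nat.exists_eq_add_of_le' hi
  obtain ⟨j, rfl⟩ := Nat.exists_eq_add_of_le' hj
  rw [← logForm_C_mul_add_C_mul_left, ← logForm_C_mul_add_C_mul_right,
    ← conformalDeriv_legendrePoly, ← conformalDeriv_legendrePoly]
  exact logForm_conformalDeriv _ _ (integral_legendrePoly_succ i) (integral_legendrePoly_succ j)

lemma logForm_legendrePoly_X_recurrence (n : ℕ) :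
    (n * (n - 3) / (2 * n + 1) : ℝ) * logForm (legendrePoly (n - 1)) X
      + (-((n + 1) * (n + 4)) / (2 * n + 1) : ℝ) * logForm (legendrePoly (n + 1)) X
      = 2 * ∫ x in (-1 : ℝ)..1, (legendrePoly n).eval x := by
  rw [← logForm_C_mul_add_C_mul_left, ← conformalDeriv_legendrePoly_sub, logForm_conformalDeriv_X]

/-- The closed form of the logarithmic bilinear form on Legendre polynomials. -/
noncomputable def logCoeff (i j : ℕ) : ℝ :=
  if Even (i + j) then -8 / ((i + j) * (i + j + 2) * (1 - ((i : ℝ) - j) ^ 2)) else 0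

lemma sub_ne_of_odd_add {i j : ℕ} (h : Odd (i + j)) {k : ℤ} (hk : Even k) : (i : ℝ) - j ≠ k := by
  intro he
  have he : (i : ℤ) - j = k := by exact_mod_cast he
  obtain ⟨a, ha⟩ := h
  obtain ⟨b, hb⟩ := hk
  lia

lemma logCoeff_recurrence {i j : ℕ} (hi : 1 ≤ i) (hj : 1 ≤ j) :
    (i * (i - 1) / (2 * i + 1) : ℝ) * logCoeff (i - 1) j
      + (-((i + 1) * (i + 2)) / (2 * i + 1) : ℝ) * logCoeff (i + 1) j
      + ((j * (j - 1) / (2 * j + 1) : ℝ) * logCoeff i (j - 1)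
      + (-((j + 1) * (j + 2)) / (2 * j + 1) : ℝ) * logCoeff i (j + 1)) = 0 := by
  by_cases h : Even (i + j)
  · have h₁ : ¬ Even (i - 1 + j) := by grind
    have h₂ : ¬ Even (i + 1 + j) := by grind
    have h₃ : ¬ Even (i + (j - 1)) := by grind
    have h₄ : ¬ Even (i + (j + 1)) := by grind
    simp [logCoeff, h₁, h₂, h₃, h₄]
  · have h₁ : Even (i - 1 + j) := by grind
    have h₂ : Even (i + 1 + j) := by grind
    have h₃ : Even (i + (j - 1)) := by grind
    have h₄ : Even (i + (j + 1)) := by grind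
    have ho := Nat.not_even_iff_odd.1 h
    have d₀ := sub_ne_of_odd_add ho (k := 0) (by decide)
    have d₁ := sub_ne_of_odd_add ho (k := 2) (by decide)
    have d₂ := sub_ne_of_odd_add ho (k := -2) (by decide)
    push_cast at d₀ d₁ d₂
    simp only [logCoeff, h₁, h₂, h₃, h₄, if_true]
    push_cast [hi, hj]
    have hi' : (1 : ℝ) ≤ i := by exact_mod_cast hi
    have hj' : (1 : ℝ) ≤ j := by exact_mod_cast hj
    have hs : (3 : ℝ) ≤ i + j := by
      obtain ⟨k, hk⟩ := ho
      exact_mod_cast (show 3 ≤ i + j by lia)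
    generalize (i : ℝ) = x at *
    generalize (j : ℝ) = y at *
    have e₀ : x - y ≠ 0 := d₀
    have e₁ : 2 - (x - y) ≠ 0 := sub_ne_zero.2 d₁.symm
    have e₂ : 2 + (x - y) ≠ 0 := fun he => d₂ (by linarith)
    have f₁ : x + y - 1 ≠ 0 := by linarith
    have f₂ : x + y + 1 ≠ 0 := by linarith
    have f₃ : x + y + 3 ≠ 0 := by linarith
    have g₁ : 2 * x + 1 ≠ 0 := by linarith
    have g₂ : 2 * y + 1 ≠ 0 := by linarith
    rw [show (x - 1 + y) * (x - 1 + y + 2) * (1 - (x - 1 - y) ^ 2)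
        = (x + y - 1) * (x + y + 1) * ((x - y) * (2 - (x - y))) by ring,
      show (x + 1 + y) * (x + 1 + y + 2) * (1 - (x + 1 - y) ^ 2)
        = -((x + y + 1) * (x + y + 3) * ((x - y) * (2 + (x - y)))) by ring,
      show (x + (y - 1)) * (x + (y - 1) + 2) * (1 - (x - (y - 1)) ^ 2)
        = -((x + y - 1) * (x + y + 1) * ((x - y) * (2 + (x - y)))) by ring,
      show (x + (y + 1)) * (x + (y + 1) + 2) * (1 - (x - (y + 1)) ^ 2)
        = (x + y + 1) * (x + y + 3) * ((x - y) * (2 - (x - y))) by ring]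
    field_simp
    ring

lemma logForm_legendrePoly_one (n : ℕ) :
    logForm (legendrePoly (n + 1)) (legendrePoly 1) = logCoeff (n + 1) 1 := by
  rw [legendrePoly_one]
  induction n using Nat.twoStepInduction with
  | zero =>
    have h := logForm_legendrePoly_X_recurrence 0
    norm_num [legendrePoly_zero] at h
    norm_num [logCoeff]
    linarith
  | one =>
    have h := logForm_legendrePoly_X_recurrence 1
    rw [integral_legendrePoly_succ 0, Nat.sub_self, legendrePoly_zero, logForm_one_X] at h
    norm_num at h
    rw [h, logCoeff, if_neg (by decide)]
  | more n ih _ =>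
    have h := logForm_legendrePoly_X_recurrence (n + 2)
    rw [integral_legendrePoly_succ, show n + 2 - 1 = n + 1 by lia, ih] at h
    push_cast at h
    have hk : logForm (legendrePoly (n + 2 + 1)) X
        = (n + 2) * (n - 1) / ((n + 3) * (n + 6)) * logCoeff (n + 1) 1 := by
      field_simp at h ⊢
      linarith
    rw [hk]
    by_cases he : Even n
    · have h₁ : Even (n + 1 + 1) := by grind
      have h₂ : Even (n + 2 + 1 + 1) := by grind
      rw [logCoeff, logCoeff, if_pos h₁, if_pos h₂]
      have hn : (n : ℝ) - 1 ≠ 0 := by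
        rw [sub_ne_zero]
        norm_cast
        rintro rfl
        exact absurd he (by decide)
      push_cast
      rw [show (n + 1 + 1 : ℝ) * (n + 1 + 1 + 2) * (1 - ((n : ℝ) + 1 - 1) ^ 2)
          = -((n + 2) * (n + 4) * ((n - 1) * (n + 1))) by ring,
        show (n + 2 + 1 + 1 : ℝ) * (n + 2 + 1 + 1 + 2) * (1 - ((n : ℝ) + 2 + 1 - 1) ^ 2)
          = -((n + 4) * (n + 6) * ((n + 1) * (n + 3))) by ring]
      field_simp
    · have h₁ : ¬ Even (n + 1 + 1) := by grind
      have h₂ : ¬ Even (n + 2 + 1 + 1) := by grind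
      rw [logCoeff, logCoeff, if_neg h₁, if_neg h₂, mul_zero]

lemma logForm_legendrePoly {i j : ℕ} (hi : 1 ≤ i) (hj : 1 ≤ j) :
    logForm (legendrePoly i) (legendrePoly j) = logCoeff i j := by
  induction j using Nat.strong_induction_on generalizing i with
  | _ j ih =>
    obtain rfl | hj₁ := hj.eq_or_lt
    · obtain ⟨n, rfl⟩ := Nat.exists_eq_add_of_le' hi
      exact logForm_legendrePoly_one n
    obtain ⟨k, rfl⟩ := Nat.exists_eq_add_of_le' hj
    have hk : 1 ≤ k := by lia
    have h₁ := logForm_legendrePoly_recurrence hi hk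
    have h₂ := logCoeff_recurrence hi hk
    have hl : (i * (i - 1) / (2 * i + 1) : ℝ) * logForm (legendrePoly (i - 1)) (legendrePoly k)
        = (i * (i - 1) / (2 * i + 1) : ℝ) * logCoeff (i - 1) k := by
      obtain rfl | hi₁ := hi.eq_or_lt
      · simp
      · rw [ih k (by lia) (by lia) hk]
    have hr : (k * (k - 1) / (2 * k + 1) : ℝ) * logForm (legendrePoly i) (legendrePoly (k - 1))
        = (k * (k - 1) / (2 * k + 1) : ℝ) * logCoeff i (k - 1) := by
      obtain rfl | hk₁ := hk.eq_or_lt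
      · simp
      · rw [ih (k - 1) (by lia) hi (by lia)]
    rw [hl, hr, ih k (by lia) (by lia) hk, ← h₂] at h₁
    refine mul_left_cancel₀ (a := (-((k + 1) * (k + 2)) / (2 * k + 1) : ℝ)) ?_
      (add_left_cancel (add_left_cancel h₁))
    exact div_ne_zero (neg_ne_zero.2 (by positivity)) (by positivity)

lemma integral_log_mul_legP (i j : ℕ) :
    (∫ x in (-1 : ℝ)..1, ∫ s in (-1 : ℝ)..1, Real.log |x - s| * legP i x * legP j s)
      = Real.sqrt (i + 1 / 2) * Real.sqrt (j + 1 / 2)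
        * logForm (legendrePoly i) (legendrePoly j) := by
  simp only [logForm, logPotential, legP_eq_eval, Real.log_abs]
  rw [← intervalIntegral.integral_const_mul]
  congr 1
  ext x
  rw [← intervalIntegral.integral_const_mul, ← intervalIntegral.integral_const_mul]
  congr 1
  ext s
  ring

lemma sqrt_two_mul_add_one (n : ℕ) :
    Real.sqrt (2 * n + 1) = Real.sqrt 2 * Real.sqrt (n + 1 / 2) := by
  rw [← Real.sqrt_mul (by norm_num)]
  congr 1
  ring

/-- for `i, j ≥ 1`, if `i + j` is even then
`−∫∫ ln|x−s| p_i(x) p_j(s) ds dx = 4√(2i+1)√(2j+1)/((i+j)(i+j+2)(1−(i−j)²))`,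
and if `i + j` is odd the double integral vanishes. -/
theorem log_kernel_legendre (i j : ℕ) (hi : 1 ≤ i) (hj : 1 ≤ j) :
    (Even (i + j) →
      -(∫ x in (-1:ℝ)..1, ∫ s in (-1:ℝ)..1, Real.log |x - s| * legP i x * legP j s) =
        4 * Real.sqrt (2*(i:ℝ) + 1) * Real.sqrt (2*(j:ℝ) + 1) /
          (((i:ℝ) + (j:ℝ)) * ((i:ℝ) + (j:ℝ) + 2) * (1 - ((i:ℝ) - (j:ℝ))^2))) ∧
    (¬ Even (i + j) →
      (∫ x in (-1:ℝ)..1, ∫ s in (-1:ℝ)..1, Real.log |x - s| * legP i x * legP j s) = 0) := by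
  rw [integral_log_mul_legP, logForm_legendrePoly hi hj, sqrt_two_mul_add_one,
    sqrt_two_mul_add_one, logCoeff]
  refine ⟨fun h => ?_, fun h => ?_⟩
  · rw [if_pos h]
    linear_combination (-4 * Real.sqrt (i + 1 / 2) * Real.sqrt (j + 1 / 2)
      / ((i + j) * (i + j + 2) * (1 - ((i : ℝ) - j) ^ 2)))
      * Real.mul_self_sqrt (show (0 : ℝ) ≤ 2 by norm_num)
  · rw [if_neg h, mul_zero]
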